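/- Let a finite discounted MDP be given with Bellman operator T and optimal value function v* (the unique fixed point v* = T v*). Let H be an N×K real matrix and G : ℝ^N → ℝ^K a map such that H∘G is a non-expansion in max-norm. If w* ∈ ℝ^K is a fixed point of the approximate value iteration, i.e. w* = G(T(H w*)), then ‖H w* − v*‖∞ ≤ (1/(1−γ)) · ‖H(G v*) − v*‖∞. -/

import Mathlib

/-- A row-stochastic matrix moves each coordinate of a vector by at most its max-norm. -/
theorem Matrix.mulVec_sub_mulVec_le_norm_sub {m n : Type*} [Fintype n]
    {P : Matrix m n ℝ} (hP0 : ∀ x y, 0 ≤ P x y) (hP1 : ∀ x, ∑ y, P x y = 1)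
    (v w : n → ℝ) (x : m) : P.mulVec v x - P.mulVec w x ≤ ‖v - w‖ := by
  calc P.mulVec v x - P.mulVec w x = ∑ y, P x y * (v - w) y := by
        simp [Matrix.mulVec, dotProduct, mul_sub, Finset.sum_sub_distrib]
    _ ≤ ∑ y, P x y * ‖v - w‖ := by
        gcongr with y
        · exact hP0 x y
        · exact (le_abs_self _).trans (norm_le_pi_norm (v - w) y)
    _ = ‖v - w‖ := by rw [← Finset.sum_mul, hP1, one_mul]

/-- The Bellman operator of a finite discounted MDP is a `γ`-contraction in max-norm. -/
theorem norm_bellman_sub_le {S A : Type*} [Fintype S] [Finite A] [Nonempty A]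
    {P : A → Matrix S S ℝ} (hP0 : ∀ a x y, 0 ≤ P a x y) (hP1 : ∀ a x, ∑ y, P a x y = 1)
    (r : A → S → ℝ) {γ : ℝ} (hγ0 : 0 ≤ γ) {T : (S → ℝ) → (S → ℝ)}
    (hT : ∀ v x, T v x = ⨆ a : A, (r a x + γ * ((P a).mulVec v) x)) (v w : S → ℝ) :
    ‖T v - T w‖ ≤ γ * ‖v - w‖ := by
  have one_sided (v w : S → ℝ) (x : S) : T v x - T w x ≤ γ * ‖v - w‖ := by
    rw [sub_le_iff_le_add, hT, hT]
    refine ciSup_le fun a ↦ ?_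
    have h₁ := le_ciSup (Set.finite_range fun a ↦ r a x + γ * ((P a).mulVec w) x).bddAbove a
    have h₂ := mul_le_mul_of_nonneg_left
      (Matrix.mulVec_sub_mulVec_le_norm_sub (hP0 a) (hP1 a) v w x) hγ0
    linarith
  refine (pi_norm_le_iff_of_nonneg (by positivity)).2 fun x ↦ abs_sub_le_iff.2 ⟨?_, ?_⟩
  · exact one_sided v w x
  · rw [norm_sub_rev]
    exact one_sided w v x

/-- If `v*` is the optimal value function (`v* = T v*`), `H ∘ G` is a
max-norm non-expansion, and `w*` is a fixed point of approximate value iteration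
(`w* = G (T (H w*))`), then `‖H w* − v*‖∞ ≤ (1/(1−γ)) ‖H (G v*) − v*‖∞`. -/
theorem avi_fixed_point_error_bound
    {N K : ℕ} {A : Type*} [Fintype A] [Nonempty A]
    (P : A → Matrix (Fin N) (Fin N) ℝ)
    (hP0 : ∀ a x y, 0 ≤ P a x y)
    (hP1 : ∀ a x, ∑ y, P a x y = 1)
    (r : A → Fin N → ℝ)
    (γ : ℝ) (hγ0 : 0 ≤ γ) (hγ1 : γ < 1)
    (T : (Fin N → ℝ) → (Fin N → ℝ))
    (hT : ∀ v x, T v x = ⨆ a : A, (r a x + γ * ((P a).mulVec v) x))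
    (H : Matrix (Fin N) (Fin K) ℝ)
    (G : (Fin N → ℝ) → (Fin K → ℝ))
    (hG : ∀ v v' : Fin N → ℝ, ‖H.mulVec (G v) - H.mulVec (G v')‖ ≤ ‖v - v'‖)
    (vstar : Fin N → ℝ) (hvstar : vstar = T vstar)
    (wstar : Fin K → ℝ) (hwstar : wstar = G (T (H.mulVec wstar))) :
    ‖H.mulVec wstar - vstar‖ ≤ (1 / (1 - γ)) * ‖H.mulVec (G vstar) - vstar‖ := by
  have hfix : H.mulVec wstar - H.mulVec (G vstar) =
      H.mulVec (G (T (H.mulVec wstar))) - H.mulVec (G (T vstar)) := by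
    rw [← hwstar, ← hvstar]
  have hcontr : ‖H.mulVec wstar - H.mulVec (G vstar)‖ ≤ γ * ‖H.mulVec wstar - vstar‖ :=
    hfix ▸ (hG _ _).trans (norm_bellman_sub_le hP0 hP1 r hγ0 hT _ _)
  have htri := norm_sub_le_norm_sub_add_norm_sub (H.mulVec wstar) (H.mulVec (G vstar)) vstar
  rw [one_div, inv_mul_eq_div, le_div_iff₀ (sub_pos.2 hγ1)]
  linarith
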